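/- arXiv:2308.06239 — 2 statements merged into one kernel-verified Lean document; each statement's English description precedes it below -/
import Mathlib

section
/- Let d ≥ 2. There exists a constant c_d > 0 depending only on d such that for every integer k ≥ 5 and every tuple x = (x₁, …, x_{d−1}) ∈ C^{d−1}, if (t, u) is drawn from the uniform distribution on T × N, then P( Π_{i=1}^{d−1} g_{1/k, t, u}(x_i) ≥ ( (2π)^{−d/2} · k · e^{−5} )^{d−1} ) ≥ c_d / k^{d−1}, where g_{σ,t,u} denotes the Lebesgue density of G(σ, t, u). Consequently, with u_k = ( (2π)^{−d/2} · k · e^{−1/2} )^{d−1} and c = exp(9(d−1)/2), s_k := inf_{x ∈ C^{d−1}} P_{(t,u) uniform}( Π_i g_{1/k,t,u}(x_i) ≥ c·u_k ) = Ω(1/k^{d−1}). -/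
open MeasureTheory Real
open scoped RealInnerProductSpace ENNReal

namespace GaussLB

noncomputable section

/-- Euclidean space `ℝ^d`. -/
abbrev Euc (d : ℕ) := EuclideanSpace ℝ (Fin d)

/-- The last coordinate index of `Fin d`. -/
def lastIdx (d : ℕ) [NeZero d] : Fin d := ⟨d - 1, Nat.sub_lt (NeZero.pos d) one_pos⟩

/-- The last standard basis vector `e_d` of `ℝ^d`. -/
def eLast (d : ℕ) [NeZero d] : Euc d := EuclideanSpace.single (lastIdx d) 1

/-- The disk `T = {(t,0) : t ∈ ℝ^{d−1}, ‖t‖ ≤ 1/2}`. -/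
def diskT (d : ℕ) [NeZero d] : Set (Euc d) :=
  {x | x (lastIdx d) = 0 ∧ ‖x‖ ≤ 1/2}

/-- The cylinder `C = {(t,λ) : t ∈ ℝ^{d−1}, ‖t‖ ≤ 1/2, λ ∈ [1,2]}`. -/
def cylC (d : ℕ) [NeZero d] : Set (Euc d) :=
  {x | x (lastIdx d) ∈ Set.Icc (1:ℝ) 2 ∧ ‖x - x (lastIdx d) • eLast d‖ ≤ 1/2}

/-- The spherical region `N = {u : ‖u‖ = 1, |u·e_d| ≤ √3/2}`. -/
def capN (d : ℕ) [NeZero d] : Set (Euc d) :=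
  {u | ‖u‖ = 1 ∧ |⟪u, eLast d⟫| ≤ Real.sqrt 3 / 2}

/-- The Lebesgue density of the Gaussian `G(σ,t,u) = N(t, I_d − (1−σ²)·u uᵀ)`:
since `det Σ = σ²` and `Σ⁻¹ = I_d + (σ⁻² − 1)·u uᵀ`, it equals
`(2π)^{−d/2} σ⁻¹ exp(−(‖x−t‖² + (σ⁻²−1)⟪u, x−t⟫²)/2)`. -/
def gdens (d : ℕ) (σ : ℝ) (t u : Euc d) (x : Euc d) : ℝ :=
  (2 * π) ^ (-(d:ℝ)/2) * σ⁻¹ *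
    Real.exp (-(‖x - t‖^2 + ((σ^2)⁻¹ - 1) * ⟪u, x - t⟫^2) / 2)

/-- The Gaussian measure `G(σ,t,u) = N(t, I_d − (1−σ²)·u uᵀ)` on `ℝ^d`. -/
def gaussTU (d : ℕ) (σ : ℝ) (t u : Euc d) : Measure (Euc d) :=
  volume.withDensity fun x => ENNReal.ofReal (gdens d σ t u x)

/-- Normalization of a measure to a probability measure. -/
def normalize {Z : Type*} [MeasurableSpace Z] (μ : Measure Z) : Measure Z :=
  (μ Set.univ)⁻¹ • μ

/-- The embedding `ℝ^{d−1} → ℝ^d` appending `0` as the last coordinate. -/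
def emb (d : ℕ) : Euc (d-1) → Euc d := fun x =>
  (EuclideanSpace.equiv (Fin d) ℝ).symm
    (fun i => if h : (i : ℕ) < d - 1 then x ⟨i, h⟩ else 0)

/-- The uniform distribution on the disk `T`: the normalized `(d−1)`-dimensional
Lebesgue measure on the disk of radius `1/2`, embedded into the hyperplane of `ℝ^d`
spanned by the first `d−1` coordinates. -/
def uniformT (d : ℕ) : Measure (Euc d) :=
  normalize ((volume.restrict {x : Euc (d-1) | ‖x‖ ≤ 1/2}).map (emb d))

/-- The uniform distribution on the spherical region `N`: the normalized cone
(surface) measure of `N`. -/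
def uniformN (d : ℕ) [NeZero d] : Measure (Euc d) :=
  normalize ((volume.restrict
      {x : Euc d | 0 < ‖x‖ ∧ ‖x‖ ≤ 1 ∧ ‖x‖⁻¹ • x ∈ capN d}).map
    (fun x => ‖x‖⁻¹ • x))

/-- The uniform distribution on `T × N`. -/
def uniformTN (d : ℕ) [NeZero d] : Measure (Euc d × Euc d) :=
  (uniformT d).prod (uniformN d)

/-- Total variation distance between two measures. -/
def tv {Z : Type*} [MeasurableSpace Z] (p q : Measure Z) : ℝ :=
  ⨆ B : {s : Set Z // MeasurableSet s}, |(p B).toReal - (q B).toReal|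

end


section helpers

variable {E : Type*} [NormedAddCommGroup E] [InnerProductSpace ℝ E]

lemma aux_inner_bound (e u y : E) (l : ℝ) (he : ‖e‖ = 1) (hu : ‖u‖ = 1) (hl : 1 ≤ l)
    (hye : ⟪y, e⟫ = l) (hy : ‖y - l • e‖ ≤ 1) (huy : ⟪u, y⟫ = 0) :
    ⟪u, e⟫ ^ 2 ≤ 1 / 2 := by
  set a := ⟪u, e⟫ with ha
  have hee : ⟪e, e⟫ = 1 := by rw [real_inner_self_eq_norm_sq, he]; norm_num
  have h1 : ⟪u - a • e, y - l • e⟫ = - (l * a) := by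
    simp only [inner_sub_left, inner_sub_right, real_inner_smul_left, real_inner_smul_right,
      hee, huy, real_inner_comm y e, hye, ← ha]
    ring
  have h2 : ‖u - a • e‖ ^ 2 = 1 - a ^ 2 := by
    rw [norm_sub_sq_real, real_inner_smul_right, ← ha, norm_smul, he, hu]
    simp only [Real.norm_eq_abs, mul_one, sq_abs]
    ring
  have h3 := abs_real_inner_le_norm (u - a • e) (y - l • e)
  rw [h1] at h3
  have h4 : |-(l * a)| ≤ ‖u - a • e‖ := h3.trans (mul_le_of_le_one_right (norm_nonneg _) hy)
  have h5 : (l * a) ^ 2 ≤ 1 - a ^ 2 := by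
    rw [← h2, ← sq_abs, ← abs_neg]
    exact pow_le_pow_left₀ (abs_nonneg _) h4 2
  nlinarith [mul_nonneg (sub_nonneg.2 hl) (sq_nonneg a), mul_nonneg (mul_nonneg (sub_nonneg.2 hl) (sub_nonneg.2 hl)) (sq_nonneg a)]

lemma aux_norm_bound (e y : E) (l : ℝ) (he : ‖e‖ = 1) (hl : l ∈ Set.Icc (1 : ℝ) 2)
    (hye : ⟪y, e⟫ = l) (hy : ‖y - l • e‖ ≤ 1) : ‖y‖ ^ 2 ≤ 5 := by
  have h2 : ‖y - l • e‖ ^ 2 = ‖y‖ ^ 2 - l ^ 2 := by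
    rw [norm_sub_sq_real, real_inner_smul_right, hye, norm_smul, he]
    simp only [Real.norm_eq_abs, mul_one, sq_abs]
    ring
  have := pow_le_pow_left₀ (norm_nonneg _) hy 2
  nlinarith [hl.1, hl.2]

/-- the squeezing map -/
noncomputable def sq_map (u : E) (k : ℝ) : E →ₗ[ℝ] E :=
  (1 / k) • LinearMap.transvection ((k - 1) • (innerSL ℝ u).toLinearMap) u

lemma sq_map_apply (u : E) (k : ℝ) (hk : k ≠ 0) (b : E) :
    sq_map u k b = ⟪u, b⟫ • u + (1 / k) • (b - ⟪u, b⟫ • u) := by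
  simp only [sq_map, LinearMap.smul_apply, LinearMap.transvection.apply]
  simp only [ContinuousLinearMap.coe_coe, innerSL_apply_apply, smul_eq_mul]
  match_scalars <;> field_simp
  ring

lemma sq_map_det [FiniteDimensional ℝ E] (u : E) (hu : ‖u‖ = 1) (k : ℝ) (hk : k ≠ 0) :
    LinearMap.det (sq_map u k) = (1 / k) ^ Module.finrank ℝ E * k := by
  rw [sq_map, LinearMap.det_smul, LinearMap.transvection.det]
  simp [hu]

/-- Squeezed ball is in the good cone. -/
lemma aux_geom (e u b : E) (k : ℝ) (hk : 5 ≤ k) (he : ‖e‖ = 1) (hu : ‖u‖ = 1)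
    (hue : ⟪u, e⟫ ^ 2 ≤ 1 / 2) (hb : ‖b - (1 / 2 : ℝ) • u‖ ≤ 1 / 8) :
    0 < ‖sq_map u k b‖ ∧ ‖sq_map u k b‖ ≤ 1 ∧
    |⟪‖sq_map u k b‖⁻¹ • sq_map u k b, e⟫| ≤ Real.sqrt 3 / 2 ∧
    ∀ y : E, ⟪u, y⟫ = 0 → ‖y‖ ^ 2 ≤ 5 →
      |⟪‖sq_map u k b‖⁻¹ • sq_map u k b, y⟫| ≤ 2 / k := by
  have hk0 : k ≠ 0 := by positivity
  rw [sq_map_apply u k hk0]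
  set s := ⟪u, b⟫ with hs
  set w := b - s • u with hw
  have huu : ⟪u, u⟫ = 1 := by rw [real_inner_self_eq_norm_sq, hu]; norm_num
  have hs1 : |s - 1 / 2| ≤ 1 / 8 := by
    have h := abs_real_inner_le_norm u (b - (1 / 2 : ℝ) • u)
    rw [inner_sub_right, real_inner_smul_right, huu, hu, ← hs] at h
    simpa using h.trans (by simpa using hb)
  obtain ⟨hs2, hs3⟩ := abs_le.1 hs1
  have huw : ⟪u, w⟫ = 0 := by
    rw [hw, inner_sub_right, real_inner_smul_right, huu, ← hs]; ring
  have hwn : ‖w‖ ≤ 1 / 8 := by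
    have h : b - (1 / 2 : ℝ) • u = w + (s - 1 / 2) • u := by rw [hw]; module
    have h2 : ‖b - (1 / 2 : ℝ) • u‖ ^ 2 = ‖w‖ ^ 2 + (s - 1 / 2) ^ 2 := by
      rw [h, norm_add_sq_real, real_inner_smul_right, real_inner_comm, huw, norm_smul, hu]
      simp
    have h3 : ‖w‖ ^ 2 ≤ (1 / 8) ^ 2 := by
      have := pow_le_pow_left₀ (norm_nonneg _) hb 2
      nlinarith [sq_nonneg (s - 1 / 2)]
    exact (abs_le_of_sq_le_sq' h3 (by norm_num)).2
  set x := s • u + (1 / k) • w with hx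
  have hux : ⟪u, x⟫ = s := by
    rw [hx, inner_add_right, real_inner_smul_right, real_inner_smul_right, huu, huw]; ring
  have hxs : s ≤ ‖x‖ := by
    have h := real_inner_le_norm u x
    rw [hux, hu, one_mul] at h
    exact h
  have hxpos : 0 < ‖x‖ := by linarith
  have hk1 : 0 < k := by linarith
  have hkinv : 1 / k ≤ 1 / 5 := one_div_le_one_div_of_le (by norm_num) hk
  have hwk : ‖(1 / k) • w‖ ≤ 1 / 40 := by
    rw [norm_smul, Real.norm_of_nonneg (by positivity)]
    calc 1 / k * ‖w‖ ≤ 1 / 5 * (1 / 8) := by gcongr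
      _ = 1 / 40 := by norm_num
  refine ⟨hxpos, ?_, ?_, ?_⟩
  · have h := norm_add_le (s • u) ((1 / k) • w)
    rw [norm_smul, hu, Real.norm_of_nonneg (by linarith)] at h
    rw [hx]; linarith
  · rw [real_inner_smul_left, abs_mul, abs_of_pos (inv_pos.2 hxpos), inv_mul_le_iff₀ hxpos]
    have h1 : |⟪x, e⟫| ≤ s * |⟪u, e⟫| + 1 / 40 := by
      rw [hx, inner_add_left, real_inner_smul_left]
      refine (abs_add_le _ _).trans ?_
      rw [abs_mul, abs_of_pos (by linarith : 0 < s)]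
      have := abs_real_inner_le_norm ((1 / k) • w) e
      rw [he] at this
      linarith
    have h2 : |⟪u, e⟫| ≤ 0.75 := by
      apply abs_le_of_sq_le_sq _ (by norm_num)
      linarith
    have h3 : (0.86 : ℝ) ≤ Real.sqrt 3 / 2 := by
      have : (1.72 : ℝ) ≤ Real.sqrt 3 := Real.le_sqrt_of_sq_le (by norm_num)
      linarith
    calc |⟪x, e⟫| ≤ s * 0.75 + 1 / 40 := h1.trans (by gcongr; linarith)
      _ ≤ s * 0.86 := by linarith
      _ ≤ ‖x‖ * (Real.sqrt 3 / 2) := by gcongr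
  · intro y huy hy
    rw [real_inner_smul_left, abs_mul, abs_of_pos (inv_pos.2 hxpos), inv_mul_le_iff₀ hxpos]
    have hy3 : ‖y‖ ≤ 3 := (abs_le_of_sq_le_sq' (by linarith : ‖y‖ ^ 2 ≤ 3 ^ 2) (by norm_num)).2
    have h1 : ⟪x, y⟫ = (1 / k) * ⟪w, y⟫ := by
      rw [hx, inner_add_left, real_inner_smul_left, real_inner_smul_left, huy]; ring
    rw [h1, abs_mul, abs_of_pos (by positivity : 0 < 1 / k)]
    have h2 : |⟪w, y⟫| ≤ 1 / 8 * 3 := (abs_real_inner_le_norm w y).trans (by gcongr)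
    calc 1 / k * |⟪w, y⟫| ≤ 1 / k * (‖x‖ * 2) := by gcongr; linarith
      _ = ‖x‖ * (2 / k) := by ring

lemma aux_exists_orth [FiniteDimensional ℝ E] {n : ℕ} (y : Fin n → E)
    (hn : n < Module.finrank ℝ E) : ∃ u : E, ‖u‖ = 1 ∧ ∀ i, ⟪u, y i⟫ = 0 := by
  have h1 := (Submodule.span ℝ (Set.range y)).finrank_add_finrank_orthogonal
  have h2 : Module.finrank ℝ (Submodule.span ℝ (Set.range y)) ≤ n := by
    simpa [Set.finrank] using finrank_range_le_card (R := ℝ) y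
  have h3 : (Submodule.span ℝ (Set.range y))ᗮ ≠ ⊥ := by
    intro h
    rw [h, finrank_bot] at h1
    omega
  obtain ⟨v, hv, hv0⟩ := Submodule.exists_mem_ne_zero_of_ne_bot h3
  refine ⟨‖v‖⁻¹ • v, norm_smul_inv_norm (𝕜 := ℝ) hv0, fun i => ?_⟩
  rw [real_inner_smul_left, real_inner_comm,
    (Submodule.mem_orthogonal _ _).1 hv _ (Submodule.subset_span ⟨i, rfl⟩), mul_zero]

end helpers

lemma eLast_norm (d : ℕ) [NeZero d] : ‖eLast d‖ = 1 := by simp [eLast]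

lemma inner_eLast (d : ℕ) [NeZero d] (y : Euc d) : ⟪y, eLast d⟫ = y (lastIdx d) := by
  simp [eLast, EuclideanSpace.inner_single_right]

lemma emb_mem (d : ℕ) [NeZero d] (x : Euc (d-1)) (hx : ‖x‖ ≤ 1/2) : emb d x ∈ diskT d := by
  obtain ⟨n, rfl⟩ : ∃ n, d = n + 1 := ⟨d - 1, by have := NeZero.pos d; omega⟩
  refine ⟨by simp [emb, lastIdx], ?_⟩
  refine le_trans (le_of_eq ?_) hx
  rw [EuclideanSpace.norm_eq, EuclideanSpace.norm_eq, Fin.sum_univ_castSucc]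
  simp [emb]

lemma emb_cont (d : ℕ) : Continuous (emb d) := by
  unfold emb
  refine (EuclideanSpace.equiv (Fin d) ℝ).symm.continuous.comp (continuous_pi fun i => ?_)
  by_cases h : (i : ℕ) < d - 1
  · simp only [h, dite_true]; fun_prop
  · simp only [h, dite_false]; fun_prop

lemma diskT_closed (d : ℕ) [NeZero d] : IsClosed (diskT d) := by
  refine IsClosed.inter (isClosed_eq (by fun_prop) continuous_const)
    (isClosed_le continuous_norm continuous_const)

lemma baseT_pos (m : ℕ) : (volume {x : Euc m | ‖x‖ ≤ 1/2}) ≠ 0 := by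
  have : {x : Euc m | ‖x‖ ≤ 1/2} = Metric.closedBall 0 (1/2) := by ext; simp
  rw [this]
  exact (Metric.measure_closedBall_pos volume _ (by norm_num)).ne'

lemma baseT_fin (m : ℕ) : (volume {x : Euc m | ‖x‖ ≤ 1/2}) ≠ ⊤ := by
  have : {x : Euc m | ‖x‖ ≤ 1/2} = Metric.closedBall 0 (1/2) := by ext; simp
  rw [this]
  exact measure_closedBall_lt_top.ne

lemma uniformT_univ (d : ℕ) : uniformT d Set.univ = 1 := by
  rw [uniformT, normalize, Measure.smul_apply, smul_eq_mul]
  rw [Measure.map_apply (emb_cont d).measurable MeasurableSet.univ]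
  simp only [Set.preimage_univ, Measure.restrict_apply_univ]
  exact ENNReal.inv_mul_cancel (baseT_pos _) (baseT_fin _)

lemma uniformT_ae (d : ℕ) [NeZero d] : ∀ᵐ t ∂(uniformT d), t ∈ diskT d := by
  rw [uniformT, normalize]
  refine Measure.ae_smul_measure ?_ _
  refine (ae_map_iff (p := fun t => t ∈ diskT d) (emb_cont d).aemeasurable
    (diskT_closed d).measurableSet).2 ?_
  refine (ae_restrict_iff' ?_).2 (ae_of_all _ fun x hx => emb_mem d x hx)
  exact (isClosed_le continuous_norm continuous_const).measurableSet

lemma normz_meas (d : ℕ) : Measurable (fun x : Euc d => ‖x‖⁻¹ • x) := by fun_prop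

/-- the sector of the unit ball over `N` -/
def sect (d : ℕ) [NeZero d] : Set (Euc d) :=
  {x : Euc d | 0 < ‖x‖ ∧ ‖x‖ ≤ 1 ∧ ‖x‖⁻¹ • x ∈ capN d}

lemma sect_le (d : ℕ) [NeZero d] : volume (sect d) ≤ volume (Metric.closedBall (0 : Euc d) 1) :=
  measure_mono fun x hx => by simpa using hx.2.1

lemma uniformN_ge (d : ℕ) [NeZero d] (B : Set (Euc d)) :
    (volume (Metric.closedBall (0 : Euc d) 1))⁻¹ *
      volume ((fun x : Euc d => ‖x‖⁻¹ • x) ⁻¹' B ∩ sect d) ≤ uniformN d B := by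
  rw [uniformN, normalize, Measure.smul_apply, smul_eq_mul]
  refine mul_le_mul' (ENNReal.inv_le_inv.2 ?_) ?_
  · rw [Measure.map_apply (normz_meas d) MeasurableSet.univ]
    simp only [Set.preimage_univ, Measure.restrict_apply_univ]
    exact sect_le d
  · exact (Measure.le_restrict_apply _ _).trans (Measure.le_map_apply (normz_meas d).aemeasurable _)

instance uniformN_sfinite (d : ℕ) [NeZero d] : SFinite (uniformN d) := by
  rw [uniformN, normalize]; infer_instance

lemma uniformN_slab (d : ℕ) [NeZero d] (hd : 2 ≤ d) (k : ℕ) (hk : 5 ≤ k)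
    (x : Fin (d-1) → Euc d) (hx : ∀ i, x i ∈ cylC d) (t : Euc d) (ht : t ∈ diskT d) :
    (volume (Metric.closedBall (0 : Euc d) 1))⁻¹ * (ENNReal.ofReal ((1 / (k : ℝ)) ^ (d-1)) *
      volume (Metric.closedBall (0 : Euc d) (1 / 8))) ≤
    uniformN d {u | ∀ i, ‖x i - t‖ ^ 2 ≤ 5 ∧ |⟪u, x i - t⟫| ≤ 2 / (k : ℝ)} := by
  have hkR : (5 : ℝ) ≤ k := by exact_mod_cast hk
  have hk0 : (k : ℝ) ≠ 0 := by positivity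
  have hy1 : ∀ i, ⟪x i - t, eLast d⟫ = (x i) (lastIdx d) := fun i => by
    rw [inner_eLast]; simp [ht.1]
  have hy2 : ∀ i, ‖(x i - t) - (x i) (lastIdx d) • eLast d‖ ≤ 1 := fun i => by
    have : (x i - t) - (x i) (lastIdx d) • eLast d = (x i - (x i) (lastIdx d) • eLast d) - t := by
      abel
    rw [this]
    have h1 := norm_sub_le (x i - (x i) (lastIdx d) • eLast d) t
    have h2 := (hx i).2
    have h3 := ht.2
    linarith
  have hy5 : ∀ i, ‖x i - t‖ ^ 2 ≤ 5 := fun i =>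
    aux_norm_bound _ _ _ (eLast_norm d) (hx i).1 (hy1 i) (hy2 i)
  obtain ⟨u, hu, huy⟩ := aux_exists_orth (fun i => x i - t) (by simp; omega)
  have hue := aux_inner_bound _ u _ _ (eLast_norm d) hu (hx ⟨0, by omega⟩).1.1 (hy1 _) (hy2 _)
    (huy _)
  refine le_trans ?_ (uniformN_ge d _)
  gcongr
  calc ENNReal.ofReal ((1 / (k : ℝ)) ^ (d-1)) * volume (Metric.closedBall (0 : Euc d) (1 / 8))
      = volume (sq_map u (k : ℝ) '' (Metric.closedBall ((1 / 2 : ℝ) • u) (1 / 8))) := by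
        rw [Measure.addHaar_image_linearMap, sq_map_det u hu _ hk0,
          Measure.addHaar_closedBall_center volume ((1 / 2 : ℝ) • u)]
        congr 2
        rw [finrank_euclideanSpace_fin]
        obtain ⟨n, rfl⟩ : ∃ n, d = n + 1 := ⟨d - 1, by omega⟩
        rw [abs_of_nonneg (by positivity)]
        simp only [Nat.add_sub_cancel, pow_succ]
        field_simp
    _ ≤ _ := by
        refine measure_mono ?_
        rintro _ ⟨b, hb, rfl⟩
        rw [Metric.mem_closedBall, dist_eq_norm] at hb
        obtain ⟨g1, g2, g3, g4⟩ := aux_geom (eLast d) u b k hkR (eLast_norm d) hu hue hb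
        refine ⟨fun i => ⟨hy5 i, g4 _ (huy i) (hy5 i)⟩, g1, g2, ?_, g3⟩
        exact norm_smul_inv_norm (𝕜 := ℝ) (norm_pos_iff.1 g1)

lemma gdens_ge (d : ℕ) (k : ℕ) (hk : 5 ≤ k) (t u x : Euc d) (h1 : ‖x - t‖ ^ 2 ≤ 5)
    (h2 : |⟪u, x - t⟫| ≤ 2 / (k : ℝ)) :
    (2*π)^(-(d:ℝ)/2) * (k:ℝ) * Real.exp (-5) ≤ gdens d (1/(k:ℝ)) t u x := by
  have hkR : (5 : ℝ) ≤ k := by exact_mod_cast hk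
  have hk0 : (0 : ℝ) < k := by positivity
  unfold gdens
  rw [one_div, inv_inv, inv_pow, inv_inv]
  gcongr
  have h3 : ⟪u, x - t⟫ ^ 2 ≤ (2 / (k : ℝ)) ^ 2 := by
    rw [← sq_abs]; exact pow_le_pow_left₀ (abs_nonneg _) h2 2
  have h4 : ((k : ℝ) ^ 2 - 1) * ⟪u, x - t⟫ ^ 2 ≤ 4 := by
    calc ((k : ℝ) ^ 2 - 1) * ⟪u, x - t⟫ ^ 2 ≤ (k : ℝ) ^ 2 * (2 / (k : ℝ)) ^ 2 := by
          gcongr; linarith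
      _ = 4 := by field_simp; norm_num
  linarith

/-- **Claim 6.5**: for `d ≥ 2`, there is a constant `c_d > 0` such that for every `k ≥ 5`
and every `x = (x₁,…,x_{d−1}) ∈ C^{d−1}`, the probability over a uniform `(t,u) ∈ T × N`
that the product density `∏ᵢ g_{1/k,t,u}(xᵢ)` is at least `((2π)^{−d/2}·k·e^{−5})^{d−1}`
is at least `c_d / k^{d−1}`; i.e. `s_k = Ω(1/k^{d−1})` with `c·u_k` as in the paper. -/
theorem alternative_hypotheses_mass (d : ℕ) [NeZero d] (hd : 2 ≤ d) :
    ∃ cd : ℝ, 0 < cd ∧ ∀ k : ℕ, 5 ≤ k → ∀ x : Fin (d-1) → Euc d, (∀ i, x i ∈ cylC d) →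
      ENNReal.ofReal (cd / (k:ℝ)^(d-1)) ≤
        uniformTN d {z | ((2*π)^(-(d:ℝ)/2) * (k:ℝ) * Real.exp (-5))^(d-1) ≤
          ∏ i : Fin (d-1), gdens d (1/(k:ℝ)) z.1 z.2 (x i)} := by
  set V := volume (Metric.closedBall (0 : Euc d) 1) with hV
  set W := volume (Metric.closedBall (0 : Euc d) (1 / 8)) with hW
  have hV0 : V ≠ 0 := (Metric.measure_closedBall_pos volume _ (by norm_num)).ne'
  have hVt : V ≠ ⊤ := measure_closedBall_lt_top.ne
  have hW0 : W ≠ 0 := (Metric.measure_closedBall_pos volume _ (by norm_num)).ne'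
  have hWt : W ≠ ⊤ := measure_closedBall_lt_top.ne
  have hVW0 : V⁻¹ * W ≠ 0 := mul_ne_zero (ENNReal.inv_ne_zero.2 hVt) hW0
  have hVWt : V⁻¹ * W ≠ ⊤ := ENNReal.mul_ne_top (ENNReal.inv_ne_top.2 hV0) hWt
  refine ⟨(V⁻¹ * W).toReal, ENNReal.toReal_pos hVW0 hVWt, fun k hk x hx => ?_⟩
  have hmeas : MeasurableSet {z : Euc d × Euc d |
      ((2*π)^(-(d:ℝ)/2) * (k:ℝ) * Real.exp (-5))^(d-1) ≤
          ∏ i : Fin (d-1), gdens d (1/(k:ℝ)) z.1 z.2 (x i)} := by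
    refine (isClosed_le continuous_const (continuous_finsetProd _ fun i _ => ?_)).measurableSet
    unfold gdens
    fun_prop
  have hc : ENNReal.ofReal ((V⁻¹ * W).toReal / (k:ℝ)^(d-1)) =
      V⁻¹ * (ENNReal.ofReal ((1 / (k : ℝ)) ^ (d-1)) * W) := by
    rw [div_eq_mul_one_div, ENNReal.ofReal_mul ENNReal.toReal_nonneg, ENNReal.ofReal_toReal hVWt,
      one_div_pow]
    ring
  rw [hc, uniformTN, Measure.prod_apply hmeas]
  calc V⁻¹ * (ENNReal.ofReal ((1 / (k : ℝ)) ^ (d-1)) * W)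
      = ∫⁻ _t, V⁻¹ * (ENNReal.ofReal ((1 / (k : ℝ)) ^ (d-1)) * W) ∂(uniformT d) := by
        rw [lintegral_const, uniformT_univ, mul_one]
    _ ≤ _ := by
        refine lintegral_mono_ae ?_
        filter_upwards [uniformT_ae d] with t ht
        refine (uniformN_slab d hd k hk x hx t ht).trans (measure_mono fun u hu => ?_)
        show _ ≤ ∏ i : Fin (d-1), gdens d (1/(k:ℝ)) t u (x i)
        calc _ = ∏ _i : Fin (d-1), ((2*π)^(-(d:ℝ)/2) * (k:ℝ) * Real.exp (-5)) := by simp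
          _ ≤ _ := Finset.prod_le_prod (fun i _ => by positivity)
            (fun i _ => gdens_ge d k hk t u (x i) (hu i).1 (hu i).2)

end GaussLB
end

section
/- Let d ≥ 2 and σ > 0. Let t₁, t₂ ∈ T and u₁, u₂ ∈ N, and let θ = ∠(u₁, u₂) = arccos(u₁ · u₂). If θ ∈ [√2·π·σ/2, π − √2·π·σ/2], then tv( G(σ, t₁, u₁), G(σ, t₂, u₂) ) ≥ 1/200. -/
open MeasureTheory Real
open scoped RealInnerProductSpace ENNReal

namespace GaussLB

open ProbabilityTheory in
theorem std_eq (d : ℕ) :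
    (volume : Measure (Euc d)).withDensity
      (fun z => ENNReal.ofReal ((2 * π) ^ (-(d:ℝ)/2) * Real.exp (-(‖z‖^2) / 2)))
      = stdGaussian (Euc d) := by
  have hint : Integrable (fun z : Euc d => Real.exp (-(‖z‖^2) / 2)) := by
    have h := GaussianFourier.integral_rexp_neg_mul_sq_norm (V := Euc d) (b := 1/2) (by norm_num)
    have h2 : ∫ z : Euc d, Real.exp (-(1/2) * ‖z‖^2) ≠ 0 := by
      rw [h]; positivity
    have h3 := not_imp_comm.1 integral_undef h2
    refine h3.congr (ae_of_all _ fun z => ?_)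
    simp only
    congr 1; ring
  haveI : IsFiniteMeasure ((volume : Measure (Euc d)).withDensity
      (fun z => ENNReal.ofReal ((2 * π) ^ (-(d:ℝ)/2) * Real.exp (-(‖z‖^2) / 2)))) :=
    isFiniteMeasure_withDensity_ofReal (hint.const_mul _).2
  apply Measure.ext_of_charFun
  ext w
  rw [charFun_stdGaussian, charFun_apply, integral_withDensity_eq_integral_toReal_smul
    (by fun_prop) (ae_of_all _ fun x => ENNReal.ofReal_lt_top)]
  have key := GaussianFourier.integral_cexp_neg_mul_sq_norm_add (V := Euc d) (b := 1/2)
    (by norm_num) Complex.I w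
  have h1 : ∀ x : Euc d, (ENNReal.ofReal ((2 * π) ^ (-(d:ℝ)/2) *
      Real.exp (-(‖x‖^2) / 2))).toReal • Complex.exp (⟪x, w⟫ * Complex.I)
      = (((2 * π) ^ (-(d:ℝ)/2) : ℝ) : ℂ) *
        Complex.exp (-(1/2) * (‖x‖:ℂ) ^ 2 + Complex.I * (⟪w, x⟫ : ℝ)) := by
    intro x
    rw [ENNReal.toReal_ofReal (by positivity), Complex.real_smul, Complex.exp_add]
    push_cast
    rw [real_inner_comm]
    rw [mul_assoc]
    congr 3
    · ring_nf
    · ring_nf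
  simp_rw [h1]
  rw [integral_const_mul, key]
  rw [← mul_assoc]
  have hpi : ((((2 * π) ^ (-(d:ℝ)/2) : ℝ) : ℂ)) *
      ((π:ℂ) / (1/2)) ^ ((Module.finrank ℝ (Euc d) : ℂ) / 2) = 1 := by
    have e1 : ((π:ℂ) / (1/2)) ^ ((Module.finrank ℝ (Euc d) : ℂ) / 2)
        = (((2 * π) ^ ((d:ℝ)/2) : ℝ) : ℂ) := by
      rw [Complex.ofReal_cpow (by positivity)]
      simp
      congr 1
      ring
    rw [e1, ← Complex.ofReal_mul, ← Real.rpow_add (by positivity)]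
    rw [neg_div, neg_add_cancel, Real.rpow_zero, Complex.ofReal_one]
  rw [hpi, one_mul]
  congr 1
  rw [Complex.I_sq]
  ring

noncomputable def shr {d : ℕ} (σ : ℝ) (u : Euc d) : Euc d →L[ℝ] Euc d :=
  LinearMap.toContinuousLinearMap
    (LinearMap.transvection (innerₛₗ ℝ u) ((σ - 1) • u))

theorem shr_apply {d : ℕ} (σ : ℝ) (u z : Euc d) :
    shr σ u z = z + ⟪u, z⟫ • ((σ - 1) • u) := rfl

theorem shr_det {d : ℕ} (σ : ℝ) (u : Euc d) (hu : ‖u‖ = 1) : (shr σ u).det = σ := by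
  unfold shr
  rw [ContinuousLinearMap.det, LinearMap.coe_toContinuousLinearMap, LinearMap.transvection.det]
  simp [inner_smul_right, hu]

theorem inner_shr {d : ℕ} (σ : ℝ) (u z : Euc d) (hu : ‖u‖ = 1) :
    ⟪u, shr σ u z⟫ = σ * ⟪u, z⟫ := by
  rw [shr_apply]
  simp [inner_add_right, inner_smul_right, hu]
  ring

theorem norm_shr {d : ℕ} (σ : ℝ) (u z : Euc d) (hu : ‖u‖ = 1) :
    ‖shr σ u z‖^2 = ‖z‖^2 - (1 - σ^2) * ⟪u, z⟫^2 := by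
  rw [shr_apply, norm_add_sq_real, smul_smul, norm_smul, hu, inner_smul_right,
    real_inner_comm, mul_one, Real.norm_eq_abs, sq_abs]
  ring

theorem gauss_eq (d : ℕ) (σ : ℝ) (hσ : 0 < σ) (t u : Euc d) (hu : ‖u‖ = 1) :
    gaussTU d σ t u = (ProbabilityTheory.stdGaussian (Euc d)).map
      (fun z => t + shr σ u z) := by
  have hbij : Function.Bijective (shr σ u) := by
    have hcomp : ∀ a b : ℝ, a * b = 1 → ∀ z, shr a u (shr b u z) = z := by
      intro a b hab z
      rw [shr_apply a, inner_shr b u z hu, shr_apply b, add_assoc, smul_smul, smul_smul, ← add_smul]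
      have : ⟪u, z⟫ * (b - 1) + b * ⟪u, z⟫ * (a - 1) = 0 := by linear_combination ⟪u, z⟫ * hab
      rw [this, zero_smul, add_zero]
    exact Function.bijective_iff_has_inverse.2 ⟨shr σ⁻¹ u,
      hcomp _ _ (inv_mul_cancel₀ hσ.ne'), hcomp _ _ (mul_inv_cancel₀ hσ.ne')⟩
  have hbij2 : Function.Bijective (fun z => t + shr σ u z) :=
    (Equiv.addLeft t).bijective.comp hbij
  have hm : Measurable (fun z => t + shr σ u z) := by fun_prop
  rw [← std_eq]
  ext S hS
  have hS' : MeasurableSet ((fun z => t + shr σ u z) ⁻¹' S) := hm hS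
  rw [Measure.map_apply hm hS, gaussTU, withDensity_apply _ hS, withDensity_apply _ hS']
  have := lintegral_image_eq_lintegral_abs_det_fderiv_mul volume hS'
    (f := fun z => t + shr σ u z) (f' := fun _ => shr σ u)
    (fun x _ => ((shr σ u).hasFDerivAt.const_add t).hasFDerivWithinAt)
    hbij2.injective.injOn (fun x => ENNReal.ofReal (gdens d σ t u x))
  rw [Set.image_preimage_eq _ hbij2.surjective] at this
  rw [this]
  apply lintegral_congr
  intro z
  rw [shr_det σ u hu, ← ENNReal.ofReal_mul (abs_nonneg _), gdens, add_sub_cancel_left,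
    norm_shr σ u z hu, inner_shr σ u z hu, abs_of_pos hσ]
  congr 1
  have : ‖z‖ ^ 2 - (1 - σ ^ 2) * ⟪u, z⟫ ^ 2 + ((σ ^ 2)⁻¹ - 1) * (σ * ⟪u, z⟫) ^ 2 = ‖z‖^2 := by
    field_simp
    ring
  rw [this]
  field_simp

open ProbabilityTheory in
theorem gauss_map (d : ℕ) (σ : ℝ) (hσ : 0 < σ) (t u v : Euc d) (hu : ‖u‖ = 1) :
    (gaussTU d σ t u).map (fun x => ⟪v, x⟫) =
      gaussianReal ⟪v, t⟫ (Real.toNNReal (‖v‖^2 - (1 - σ^2) * ⟪u, v⟫^2)) := by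
  rw [gauss_eq d σ hσ t u hu, Measure.map_map (by fun_prop) (by fun_prop)]
  haveI : IsProbabilityMeasure (Measure.map ((fun x => ⟪v, x⟫) ∘ fun z => t + shr σ u z)
      (stdGaussian (Euc d))) := Measure.isProbabilityMeasure_map (by fun_prop)
  apply Measure.ext_of_charFun
  ext r
  rw [charFun_gaussianReal, charFun_apply_real, integral_map (by fun_prop) (by fun_prop)]
  have h1 : ∀ z : Euc d, Complex.exp (r * (((fun x => ⟪v, x⟫) ∘ fun z => t + shr σ u z) z : ℝ)
      * Complex.I) = Complex.exp (r * (⟪v, t⟫ : ℝ) * Complex.I) *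
        Complex.exp ((⟪z, r • shr σ u v⟫ : ℝ) * Complex.I) := by
    intro z
    rw [← Complex.exp_add]
    congr 1
    have : ⟪z, shr σ u v⟫ = ⟪v, shr σ u z⟫ := by
      simp only [shr_apply, inner_add_right, inner_smul_right]
      rw [real_inner_comm z v, real_inner_comm v u, real_inner_comm z u]
      ring
    rw [inner_smul_right, this]
    simp only [Function.comp, inner_add_right]
    push_cast
    ring
  simp_rw [h1]
  rw [integral_const_mul, ← charFun_apply, charFun_stdGaussian, ← Complex.exp_add]
  congr 1
  rw [Real.coe_toNNReal _ (by rw [← norm_shr σ u v hu]; positivity), ← norm_shr σ u v hu,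
    norm_smul]
  push_cast
  rw [mul_pow, ← Complex.ofReal_pow ‖r‖, Real.norm_eq_abs, sq_abs]
  push_cast
  ring

instance gauss_prob (d : ℕ) (σ : ℝ) [Fact (0 < σ)] (t u : Euc d) [hu : Fact (‖u‖ = 1)] :
    IsProbabilityMeasure (gaussTU d σ t u) := by
  rw [gauss_eq d σ Fact.out t u hu.out]
  exact Measure.isProbabilityMeasure_map (by fun_prop)

theorem le_tv {Z : Type*} [MeasurableSpace Z] (p q : Measure Z) [IsProbabilityMeasure p]
    [IsProbabilityMeasure q] (B : Set Z) (hB : MeasurableSet B) :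
    p.real B - q.real B ≤ tv p q := by
  refine (le_abs_self _).trans (le_ciSup (f := fun B : {s : Set Z // MeasurableSet s} =>
    |(p B).toReal - (q B).toReal|) ⟨1, ?_⟩ ⟨B, hB⟩)
  rintro _ ⟨C, rfl⟩
  have h1 : p.real C ≤ 1 := measureReal_le_one
  have h2 : q.real C ≤ 1 := measureReal_le_one
  have h3 : 0 ≤ p.real C := measureReal_nonneg
  have h4 : 0 ≤ q.real C := measureReal_nonneg
  simp only [Measure.real] at h1 h2 h3 h4
  rw [abs_le]
  constructor <;> linarith

open ProbabilityTheory in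
theorem real_lower (a σ : ℝ) (hσ : 0 < σ) (v : NNReal) (hv : (v:ℝ) = σ^2) :
    (√(2 * π))⁻¹ * (7/8) ≤ (gaussianReal a v).real (Set.Icc (a - σ/2) (a + σ/2)) := by
  have hv0 : v ≠ 0 := by
    rintro rfl
    simp at hv; nlinarith [sq_pos_of_pos hσ]
  rw [Measure.real, gaussianReal_apply_eq_integral _ hv0, ENNReal.toReal_ofReal
    (setIntegral_nonneg measurableSet_Icc fun x _ => gaussianPDFReal_nonneg _ _ _)]
  have hc : ∫ x in Set.Icc (a - σ/2) (a + σ/2), ((√(2 * π))⁻¹ * σ⁻¹ * (7/8)) =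
      (√(2 * π))⁻¹ * (7/8) := by
    rw [setIntegral_const, Real.volume_real_Icc_of_le (by linarith)]
    rw [smul_eq_mul]
    field_simp
    ring
  rw [← hc]
  refine setIntegral_mono_on (integrable_const _) (integrable_gaussianPDFReal _ _).integrableOn
    measurableSet_Icc ?_
  intro x hx
  rw [gaussianPDFReal, hv, Real.sqrt_mul (x := 2 * π) (by positivity) (σ^2), Real.sqrt_sq hσ.le, mul_inv]
  gcongr
  have h1 : (x - a)^2 ≤ σ^2/4 := by
    have := hx.1; have := hx.2
    nlinarith
  have h2 : -(1/8) ≤ -(x-a)^2 / (2 * σ^2) := by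
    rw [le_div_iff₀ (by positivity)]
    linarith
  have := Real.add_one_le_exp (-(x-a)^2 / (2 * σ^2))
  linarith

open ProbabilityTheory in
theorem real_upper (a b σ : ℝ) (hσ : 0 < σ) (v : NNReal) (hv : 2 * σ^2 ≤ (v:ℝ)) :
    (gaussianReal b v).real (Set.Icc (a - σ/2) (a + σ/2)) ≤ (√(2 * π))⁻¹ * (√2)⁻¹ := by
  have hv0 : v ≠ 0 := by
    rintro rfl
    simp at hv; nlinarith [sq_pos_of_pos hσ]
  rw [Measure.real, gaussianReal_apply_eq_integral _ hv0, ENNReal.toReal_ofReal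
    (setIntegral_nonneg measurableSet_Icc fun x _ => gaussianPDFReal_nonneg _ _ _)]
  have hc : ∫ x in Set.Icc (a - σ/2) (a + σ/2), ((√(2 * π))⁻¹ * ((√2)⁻¹ * σ⁻¹)) =
      (√(2 * π))⁻¹ * (√2)⁻¹ := by
    rw [setIntegral_const, Real.volume_real_Icc_of_le (by linarith)]
    rw [smul_eq_mul]
    field_simp
    ring
  rw [← hc]
  refine setIntegral_mono_on (integrable_gaussianPDFReal _ _).integrableOn (integrable_const _)
    measurableSet_Icc ?_
  intro x hx
  rw [gaussianPDFReal, Real.sqrt_mul (x := 2 * π) (by positivity) (v:ℝ), mul_inv, mul_assoc]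
  refine mul_le_mul_of_nonneg_left ?_ (by positivity)
  have h1 : √2 * σ ≤ √(v:ℝ) := by
    apply Real.le_sqrt_of_sq_le
    rw [mul_pow, Real.sq_sqrt (by norm_num)]
    exact hv
  have h2 : Real.exp (-(x-b)^2 / (2 * (v:ℝ))) ≤ 1 := by
    rw [Real.exp_le_one_iff]
    apply div_nonpos_of_nonpos_of_nonneg
    · nlinarith [sq_nonneg (x-b)]
    · positivity
  calc (√(v:ℝ))⁻¹ * Real.exp (-(x-b)^2 / (2 * (v:ℝ))) ≤ (√(v:ℝ))⁻¹ * 1 := by gcongr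
    _ ≤ (√2 * σ)⁻¹ := by
      rw [mul_one]
      exact inv_anti₀ (by positivity) h1
    _ = _ := by rw [mul_inv]

theorem var_bound (σ c : ℝ) (hσ : 0 < σ) (hc : |c| ≤ 1)
    (hθ : Real.arccos c ∈
      Set.Icc (Real.sqrt 2 * π * σ / 2) (π - Real.sqrt 2 * π * σ / 2)) :
    2 * σ^2 ≤ 1 - (1 - σ^2) * c^2 := by
  obtain ⟨h1, h2⟩ := hθ
  have hp := Real.pi_pos
  have hs : √2 * σ ≤ Real.sin (Real.arccos c) := by
    rcases le_total (Real.arccos c) (π/2) with h | h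
    · have := Real.mul_le_sin (Real.arccos_nonneg c) h
      refine le_trans ?_ this
      calc √2 * σ = 2/π * (√2 * π * σ / 2) := by field_simp
        _ ≤ _ := by gcongr
    · have := Real.mul_le_sin (x := π - Real.arccos c)
        (by linarith [Real.arccos_le_pi c]) (by linarith)
      rw [Real.sin_pi_sub] at this
      refine le_trans ?_ this
      calc √2 * σ = 2/π * (√2 * π * σ / 2) := by field_simp
        _ ≤ _ := by gcongr; linarith
  have hσ2 : √2 * σ ≤ 1 := hs.trans (Real.sin_le_one _)
  rw [Real.sin_arccos] at hs
  have hc2 : c^2 ≤ 1 := (sq_le_one_iff_abs_le_one c).2 hc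
  have a1 : 2 * σ^2 ≤ 1 - c^2 := by
    have : (√2 * σ)^2 ≤ (√(1-c^2))^2 := by gcongr
    rwa [mul_pow, Real.sq_sqrt (by norm_num), Real.sq_sqrt (by linarith)] at this
  have a2 : 2 * σ^2 ≤ 1 := by nlinarith [sq_nonneg c]
  nlinarith [mul_nonneg (sub_nonneg.2 a1) (show 0 ≤ 1 - σ^2 by nlinarith [sq_nonneg σ]),
    mul_nonneg (sq_nonneg σ) (sub_nonneg.2 a2)]

/-- If the angle `θ = ∠(u₁,u₂) = arccos(u₁·u₂)` satisfies
`θ ∈ [√2·π·σ/2, π − √2·π·σ/2]`, then `tv(G(σ,t₁,u₁), G(σ,t₂,u₂)) ≥ 1/200`. -/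
theorem tv_lower_bound_of_angle (d : ℕ) [NeZero d] (hd : 2 ≤ d)
    (σ : ℝ) (hσ : 0 < σ)
    (t₁ t₂ : Euc d) (ht₁ : t₁ ∈ diskT d) (ht₂ : t₂ ∈ diskT d)
    (u₁ u₂ : Euc d) (hu₁ : u₁ ∈ capN d) (hu₂ : u₂ ∈ capN d)
    (hθ : Real.arccos ⟪u₁, u₂⟫ ∈
      Set.Icc (Real.sqrt 2 * π * σ / 2) (π - Real.sqrt 2 * π * σ / 2)) :
    1/200 ≤ tv (gaussTU d σ t₁ u₁) (gaussTU d σ t₂ u₂) := by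
  have hn1 : ‖u₁‖ = 1 := hu₁.1
  have hn2 : ‖u₂‖ = 1 := hu₂.1
  haveI : Fact (0 < σ) := ⟨hσ⟩
  haveI : Fact (‖u₁‖ = 1) := ⟨hn1⟩
  haveI : Fact (‖u₂‖ = 1) := ⟨hn2⟩
  have hm : Measurable (fun x : Euc d => ⟪u₁, x⟫) := by fun_prop
  have hc : |⟪u₁, u₂⟫| ≤ 1 := by
    have := abs_real_inner_le_norm u₁ u₂
    rwa [hn1, hn2, mul_one] at this
  have hvb := var_bound σ _ hσ hc hθ
  set I := Set.Icc (⟪u₁, t₁⟫ - σ/2) (⟪u₁, t₁⟫ + σ/2) with hI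
  have hIm : MeasurableSet I := measurableSet_Icc
  have h := le_tv (gaussTU d σ t₁ u₁) (gaussTU d σ t₂ u₂)
    ((fun x : Euc d => ⟪u₁, x⟫) ⁻¹' I) (hm hIm)
  rw [← map_measureReal_apply hm hIm, ← map_measureReal_apply hm hIm, gauss_map d σ hσ t₁ u₁ u₁ hn1,
    gauss_map d σ hσ t₂ u₂ u₁ hn2] at h
  have l := real_lower ⟪u₁, t₁⟫ σ hσ
    (Real.toNNReal (‖u₁‖^2 - (1 - σ^2) * ⟪u₁, u₁⟫^2)) (by
      rw [real_inner_self_eq_norm_sq, hn1, Real.coe_toNNReal _ (by ring_nf; positivity)]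
      ring)
  have r := real_upper ⟪u₁, t₁⟫ ⟪u₁, t₂⟫ σ hσ
    (Real.toNNReal (‖u₁‖^2 - (1 - σ^2) * ⟪u₂, u₁⟫^2)) (by
      rw [real_inner_comm, hn1, one_pow]
      exact hvb.trans (Real.le_coe_toNNReal _))
  have e1 : (√2)⁻¹ ≤ 3/4 := by
    rw [inv_le_comm₀ (by positivity) (by norm_num)]
    apply Real.le_sqrt_of_sq_le
    norm_num
  have e2 : (1:ℝ)/3 ≤ (√(2 * π))⁻¹ := by
    rw [one_div]
    apply inv_anti₀ (by positivity)
    rw [Real.sqrt_le_left (by norm_num)]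
    nlinarith [Real.pi_lt_four]
  have e3 : (√(2 * π))⁻¹ * (√2)⁻¹ ≤ (√(2 * π))⁻¹ * (3/4) := by gcongr
  linarith

end GaussLB
end
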